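/- There exists δ₀>0 such that for every fixed δ∈(0,δ₀), with probability tending to 1 as n → ∞, a random graph G ~ G(n,1/2) has the following property: for every bisection A∪B of G and every pair of subsets A′⊆A and B′⊆B each of size ⌊δn⌋, the bisection A₁∪B₁ with A₁=(A∖A′)∪B′ and B₁=(B∖B′)∪A′ satisfies |Δ_{A₁,B₁} − Δ_{A,B}| ≤ δ^{1/3} n^{3/2}. -/

import Mathlib

open Finset Filter

open scoped Classical

/-- The number of neighbours of `v` (in the graph `G`) lying in the set `S`. -/
noncomputable def degIn {n : ℕ} (G : SimpleGraph (Fin n)) (S : Finset (Fin n)) (v : Fin n) : ℕ :=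
  (S.filter fun w => G.Adj v w).card

/-- The friendliness of a vertex `v` with respect to the bisection `A ∪ Aᶜ`:
the number of neighbours in its own part minus the number of neighbours across. -/
noncomputable def friendliness {n : ℕ} (G : SimpleGraph (Fin n)) (A : Finset (Fin n))
    (v : Fin n) : ℤ :=
  if v ∈ A then (degIn G A v : ℤ) - (degIn G Aᶜ v : ℤ)
  else (degIn G Aᶜ v : ℤ) - (degIn G A v : ℤ)

/-- `A ∪ Aᶜ` is a bisection: the parts' sizes differ by at most one. -/
def IsBisection {n : ℕ} (A : Finset (Fin n)) : Prop :=
  |(A.card : ℤ) - (Aᶜ.card : ℤ)| ≤ 1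

/-- The probability, under the uniform measure on simple graphs on `Fin n`
(i.e. the Erdős–Rényi measure `G(n,1/2)`), of the set of graphs satisfying `P`. -/
noncomputable def graphProb (n : ℕ) (P : SimpleGraph (Fin n) → Prop) : ℝ :=
  ((univ.filter P).card : ℝ) / (Fintype.card (SimpleGraph (Fin n)) : ℝ)

/-- The total friendliness of the bisection `A ∪ Aᶜ`. -/
noncomputable def totalFriendliness {n : ℕ} (G : SimpleGraph (Fin n))
    (A : Finset (Fin n)) : ℤ :=
  ∑ v, friendliness G A v

/-- The ordered pairs `(v, w)` with `v < w`, which index the potential edges of a graph. -/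
def orderedPairs (n : ℕ) : Finset (Fin n × Fin n) :=
  univ.filter fun p => p.1 < p.2

/-- The indicator of `A` with values `1` on `A` and `-1` off `A`. -/
noncomputable def sideSign {n : ℕ} (A : Finset (Fin n)) (v : Fin n) : ℝ :=
  if v ∈ A then 1 else -1

theorem sum_sum_eq_two_mul_sum_orderedPairs {n : ℕ} (f : Fin n → Fin n → ℝ)
    (hsymm : ∀ v w, f v w = f w v) (hdiag : ∀ v, f v v = 0) :
    ∑ v, ∑ w, f v w = 2 * ∑ p ∈ orderedPairs n, f p.1 p.2 := by
  have hswap : ∑ p : Fin n × Fin n, (if p.2 < p.1 then f p.1 p.2 else 0) =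
      ∑ p : Fin n × Fin n, (if p.1 < p.2 then f p.1 p.2 else 0) := by
    refine Fintype.sum_equiv (Equiv.prodComm _ _) _ _ fun p => ?_
    exact if_congr Iff.rfl (hsymm p.1 p.2) rfl
  have hsplit : ∀ p : Fin n × Fin n, f p.1 p.2 =
      (if p.1 < p.2 then f p.1 p.2 else 0) + (if p.2 < p.1 then f p.1 p.2 else 0) := by
    rintro ⟨v, w⟩
    rcases lt_trichotomy v w with h | rfl | h
    · simp [h, h.not_gt]
    · simp [hdiag]
    · simp [h, h.not_gt]
  rw [← Fintype.sum_prod_type', Finset.sum_congr rfl fun p _ => hsplit p, sum_add_distrib, hswap,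
    orderedPairs, sum_filter]
  ring

theorem sum_simpleGraph_prod {n : ℕ} (f g : Fin n × Fin n → ℝ) :
    ∑ G : SimpleGraph (Fin n),
        ∏ p ∈ orderedPairs n, (if G.Adj p.1 p.2 then f p else g p) =
      ∏ p ∈ orderedPairs n, (f p + g p) := by
  rw [prod_add]
  refine sum_bij' (fun G _ => (orderedPairs n).filter fun p => G.Adj p.1 p.2)
    (fun t _ => SimpleGraph.fromRel fun v w => (v, w) ∈ t) ?_ ?_ ?_ ?_ ?_
  · intro G _
    simp
  · simp
  · intro G _
    ext v w
    simp only [SimpleGraph.fromRel_adj, orderedPairs, mem_filter, mem_univ, true_and]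
    constructor
    · rintro ⟨_, h | h⟩
      · exact h.2
      · exact h.2.symm
    · intro h
      refine ⟨h.ne, ?_⟩
      rcases lt_or_gt_of_ne h.ne with h' | h'
      · exact Or.inl ⟨h', h⟩
      · exact Or.inr ⟨h', h.symm⟩
  · intro t ht
    rw [mem_powerset] at ht
    have hlt : ∀ v w, (v, w) ∈ t → v < w := fun v w h => by
      simpa [orderedPairs] using ht h
    ext ⟨v, w⟩
    simp only [SimpleGraph.fromRel_adj, orderedPairs, mem_filter, mem_univ, true_and]
    constructor
    · rintro ⟨h, _, h' | h'⟩
      · exact h'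
      · exact absurd (hlt _ _ h') h.not_gt
    · intro h
      exact ⟨hlt _ _ h, (hlt _ _ h).ne, Or.inl h⟩
  · intro G _
    rw [prod_ite, ← filter_not]

theorem sum_exp_signed_sum_le {n : ℕ} (d : Fin n × Fin n → ℝ) :
    ∑ G : SimpleGraph (Fin n),
        Real.exp (∑ p ∈ orderedPairs n, (if G.Adj p.1 p.2 then 1 else -1) * d p) ≤
      Fintype.card (SimpleGraph (Fin n)) *
        Real.exp ((∑ p ∈ orderedPairs n, d p ^ 2) / 2) := by
  have hcard : (Fintype.card (SimpleGraph (Fin n)) : ℝ) = ∏ _p ∈ orderedPairs n, 2 := by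
    have h := sum_simpleGraph_prod (n := n) (fun _ => 1) (fun _ => 1)
    norm_num at h
    simpa using h
  have hprod : ∀ G : SimpleGraph (Fin n),
      Real.exp (∑ p ∈ orderedPairs n, (if G.Adj p.1 p.2 then 1 else -1) * d p) =
        ∏ p ∈ orderedPairs n,
          (if G.Adj p.1 p.2 then Real.exp (d p) else Real.exp (-d p)) := by
    intro G
    rw [Real.exp_sum]
    refine prod_congr rfl fun p _ => ?_
    split_ifs <;> simp
  rw [sum_congr rfl fun G _ => hprod G, sum_simpleGraph_prod, hcard, sum_div, Real.exp_sum,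
    ← prod_mul_distrib]
  refine prod_le_prod (fun p _ => by positivity) fun p _ => ?_
  have h := Real.cosh_le_exp_half_sq (d p)
  rw [Real.cosh_eq] at h
  linarith

theorem card_lt_abs_signed_sum_le {n : ℕ} (d : Fin n × Fin n → ℝ) {t V : ℝ} (ht : 0 ≤ t)
    (hV : 0 < V) (hd : ∑ p ∈ orderedPairs n, d p ^ 2 ≤ V) :
    ((univ.filter fun G : SimpleGraph (Fin n) =>
        t < |∑ p ∈ orderedPairs n, (if G.Adj p.1 p.2 then 1 else -1) * d p|).card : ℝ) ≤
      2 * Fintype.card (SimpleGraph (Fin n)) * Real.exp (-(t ^ 2 / (2 * V))) := by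
  set Z : SimpleGraph (Fin n) → ℝ := fun G =>
    ∑ p ∈ orderedPairs n, (if G.Adj p.1 p.2 then 1 else -1) * d p with hZ
  set N : ℝ := (Fintype.card (SimpleGraph (Fin n)) : ℝ)
  have hmgf : ∀ s : ℝ, ∑ G, Real.exp (s * Z G) ≤ N * Real.exp (s ^ 2 * V / 2) := by
    intro s
    have h := sum_exp_signed_sum_le (n := n) fun p => s * d p
    have hs : ∀ G : SimpleGraph (Fin n), s * Z G =
        ∑ p ∈ orderedPairs n, (if G.Adj p.1 p.2 then 1 else -1) * (s * d p) := by
      intro G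
      rw [hZ, mul_sum]
      exact sum_congr rfl fun p _ => by ring
    rw [sum_congr rfl fun G _ => congrArg Real.exp (hs G)]
    refine h.trans ?_
    simp only [mul_pow]
    rw [← mul_sum]
    gcongr
  set s := t / V with hs
  have hs0 : 0 ≤ s := by positivity
  have hmarkov : ((univ.filter fun G => t < |Z G|).card : ℝ) * Real.exp (s * t) ≤
      ∑ G, (Real.exp (s * Z G) + Real.exp (-s * Z G)) := by
    rw [← nsmul_eq_mul]
    refine (card_nsmul_le_sum _ (fun G => Real.exp (s * Z G) + Real.exp (-s * Z G)) _ ?_).trans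
      (sum_le_sum_of_subset_of_nonneg (filter_subset _ _) fun _ _ _ => by positivity)
    intro G hG
    have hG' : t < |Z G| := (mem_filter.1 hG).2
    rcases lt_abs.1 hG' with h | h
    · have : Real.exp (s * t) ≤ Real.exp (s * Z G) := by gcongr
      have := Real.exp_pos (-s * Z G)
      linarith
    · have : Real.exp (s * t) ≤ Real.exp (-s * Z G) := by
        rw [neg_mul_comm]
        gcongr
      have := Real.exp_pos (s * Z G)
      linarith
  have htotal : ((univ.filter fun G => t < |Z G|).card : ℝ) * Real.exp (s * t) ≤
      2 * N * Real.exp (s ^ 2 * V / 2) := by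
    have h₁ := hmgf s
    have h₂ := hmgf (-s)
    rw [neg_sq] at h₂
    rw [sum_add_distrib] at hmarkov
    linarith
  rw [← le_div_iff₀ (Real.exp_pos _), mul_div_assoc, ← Real.exp_sub] at htotal
  have hexponent : s ^ 2 * V / 2 - s * t = -(t ^ 2 / (2 * V)) := by
    rw [hs]
    field_simp
    ring
  rwa [hexponent] at htotal

theorem totalFriendliness_eq_sum {n : ℕ} (G : SimpleGraph (Fin n)) (A : Finset (Fin n)) :
    (totalFriendliness G A : ℝ) =
      ∑ v, ∑ w, (if G.Adj v w then 1 else 0) * (sideSign A v * sideSign A w) := by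
  have hdeg : ∀ (S : Finset (Fin n)) v, (degIn G S v : ℝ) =
      ∑ w, if w ∈ S then (if G.Adj v w then 1 else 0) else 0 := by
    intro S v
    rw [degIn, card_filter, sum_ite_mem, univ_inter, Nat.cast_sum]
    simp only [Nat.cast_ite, Nat.cast_one, Nat.cast_zero]
  unfold totalFriendliness friendliness
  push_cast
  refine sum_congr rfl fun v _ => ?_
  by_cases hv : v ∈ A <;>
  · simp only [hv, if_true, if_false, sideSign]
    rw [hdeg, hdeg, ← sum_sub_distrib]
    refine sum_congr rfl fun w _ => ?_
    by_cases hw : w ∈ A <;> simp [hw]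

theorem sum_sideSign {n : ℕ} (A : Finset (Fin n)) : ∑ v, sideSign A v = 2 * A.card - n := by
  have h : ∀ v, sideSign A v = 2 * (if v ∈ A then 1 else 0) - 1 := by
    intro v
    unfold sideSign
    split_ifs <;> norm_num
  simp [h, mul_comm]

/-- For equinumerous `A` and `B`, the total friendlinesses of `A` and `B` differ by a signed sum
over potential edges. -/
theorem totalFriendliness_sub_eq {n : ℕ} (G : SimpleGraph (Fin n)) {A B : Finset (Fin n)}
    (hAB : B.card = A.card) :
    (totalFriendliness G B : ℝ) - totalFriendliness G A =
      ∑ p ∈ orderedPairs n, (if G.Adj p.1 p.2 then 1 else -1) *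
        (sideSign B p.1 * sideSign B p.2 - sideSign A p.1 * sideSign A p.2) := by
  have hsq : ∀ (C : Finset (Fin n)) v, sideSign C v * sideSign C v = 1 := by
    intro C v
    unfold sideSign
    split_ifs <;> norm_num
  have hzero : ∑ v, ∑ w, (sideSign B v * sideSign B w - sideSign A v * sideSign A w) = 0 := by
    simp only [sum_sub_distrib, ← mul_sum, ← sum_mul, sum_sideSign, hAB, sub_self]
  have h := sum_sum_eq_two_mul_sum_orderedPairs (fun v w => (if G.Adj v w then (1 : ℝ) else -1) *
      (sideSign B v * sideSign B w - sideSign A v * sideSign A w))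
    (fun v w => by simp only [G.adj_comm v w]; ring) (fun v => by simp [hsq])
  have h' : ∀ v w, (if G.Adj v w then (1 : ℝ) else -1) *
      (sideSign B v * sideSign B w - sideSign A v * sideSign A w) =
      2 * ((if G.Adj v w then 1 else 0) * (sideSign B v * sideSign B w) -
        (if G.Adj v w then 1 else 0) * (sideSign A v * sideSign A w)) -
      (sideSign B v * sideSign B w - sideSign A v * sideSign A w) := by
    intro v w
    split_ifs <;> ring
  rw [sum_congr rfl fun v _ => sum_congr rfl fun w _ => h' v w] at h
  simp only [sum_sub_distrib, ← mul_sum] at h hzero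
  rw [totalFriendliness_eq_sum, totalFriendliness_eq_sum]
  simp only [mul_sub, sum_sub_distrib] at h ⊢
  linarith

theorem sum_orderedPairs_sq_le {n : ℕ} {A B S : Finset (Fin n)}
    (hS : ∀ v, v ∉ S → sideSign B v = sideSign A v) :
    ∑ p ∈ orderedPairs n,
        (sideSign B p.1 * sideSign B p.2 - sideSign A p.1 * sideSign A p.2) ^ 2 ≤
      4 * S.card * n := by
  have hsign : ∀ (C : Finset (Fin n)) v, sideSign C v = 1 ∨ sideSign C v = -1 := by
    intro C v
    unfold sideSign
    split_ifs <;> simp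
  have hsq : ∀ (C : Finset (Fin n)) v, sideSign C v * sideSign C v = 1 := by
    intro C v
    rcases hsign C v with h | h <;> rw [h] <;> norm_num
  have h := sum_sum_eq_two_mul_sum_orderedPairs
    (fun v w => (sideSign B v * sideSign B w - sideSign A v * sideSign A w) ^ 2)
    (fun v w => by ring) (fun v => by simp [hsq])
  have hterm : ∀ v w, (sideSign B v * sideSign B w - sideSign A v * sideSign A w) ^ 2 ≤
      4 * (if v ∈ S then 1 else 0) + 4 * (if w ∈ S then 1 else 0) := by
    intro v w
    by_cases hvw : v ∉ S ∧ w ∉ S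
    · simp [hS v hvw.1, hS w hvw.2, hvw]
    · have hleft : (sideSign B v * sideSign B w - sideSign A v * sideSign A w) ^ 2 ≤ 4 := by
        rcases hsign B v with h₁ | h₁ <;> rcases hsign B w with h₂ | h₂ <;>
          rcases hsign A v with h₃ | h₃ <;> rcases hsign A w with h₄ | h₄ <;>
          rw [h₁, h₂, h₃, h₄] <;> norm_num
      refine hleft.trans ?_
      by_cases hv : v ∈ S
      · simp only [hv, if_true]
        split_ifs <;> norm_num
      · have hw : w ∈ S := by tauto
        simp [hv, hw]
  have hle := sum_le_sum fun v (_ : v ∈ univ) =>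
    sum_le_sum fun w (_ : w ∈ univ) => hterm v w
  rw [h] at hle
  simp [sum_add_distrib] at hle
  linarith

theorem card_swap {α : Type*} [Fintype α] [DecidableEq α] {A A' B' : Finset α} (hA : A' ⊆ A)
    (hB : B' ⊆ Aᶜ) (hcard : A'.card = B'.card) : ((A \ A') ∪ B').card = A.card := by
  have hdisj : Disjoint (A \ A') B' :=
    disjoint_of_subset_left sdiff_subset (disjoint_of_subset_right hB disjoint_compl_right)
  rw [card_union_of_disjoint hdisj, ← hcard, card_sdiff_add_card_eq_card hA]

theorem card_totalFriendliness_swap_le {n k : ℕ} {A A' B' : Finset (Fin n)} (hA : A' ⊆ A)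
    (hB : B' ⊆ Aᶜ) (hA' : A'.card = k) (hB' : B'.card = k) {t V : ℝ} (ht : 0 ≤ t) (hV : 0 < V)
    (hk : 8 * (k : ℝ) * n ≤ V) :
    ((univ.filter fun G : SimpleGraph (Fin n) =>
        t < |(totalFriendliness G ((A \ A') ∪ B') : ℝ) - totalFriendliness G A|).card : ℝ) ≤
      2 * Fintype.card (SimpleGraph (Fin n)) * Real.exp (-(t ^ 2 / (2 * V))) := by
  simp only [totalFriendliness_sub_eq _ (card_swap hA hB (hA'.trans hB'.symm))]
  refine card_lt_abs_signed_sum_le _ ht hV ?_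
  refine (sum_orderedPairs_sq_le (S := A' ∪ B') ?_).trans (le_trans ?_ hk)
  · intro v hv
    rw [notMem_union] at hv
    simp [sideSign, hv]
  · have h : ((A' ∪ B').card : ℝ) ≤ 2 * k := by
      have := card_union_le A' B'
      rw [hA', hB'] at this
      exact_mod_cast this.trans (by omega)
    have := mul_le_mul_of_nonneg_right h (Nat.cast_nonneg (α := ℝ) n)
    linarith

theorem one_sub_le_graphProb_forall {n : ℕ} {ι : Type*} (I : Finset ι)
    (Q : ι → SimpleGraph (Fin n) → Prop) {ε : ℝ}
    (h : ∀ i ∈ I, ((univ.filter fun G => ¬ Q i G).card : ℝ) ≤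
      ε * Fintype.card (SimpleGraph (Fin n))) :
    1 - I.card * ε ≤ graphProb n fun G => ∀ i ∈ I, Q i G := by
  have hN : (0 : ℝ) < Fintype.card (SimpleGraph (Fin n)) := by
    exact_mod_cast Fintype.card_pos
  obtain ⟨P, hP⟩ : ∃ P : SimpleGraph (Fin n) → Prop, P = fun G => ∀ i ∈ I, Q i G := ⟨_, rfl⟩
  rw [← hP, graphProb, le_div_iff₀ hN]
  have hbad : (univ.filter fun G => ¬ P G) ⊆
      I.biUnion fun i => univ.filter fun G => ¬ Q i G := by
    intro G hG
    simpa [hP] using hG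
  have hle : ((univ.filter fun G => ¬ P G).card : ℝ) ≤
      I.card * (ε * Fintype.card (SimpleGraph (Fin n))) := by
    rw [← nsmul_eq_mul]
    refine le_trans ?_ (sum_le_card_nsmul I _ _ h)
    exact_mod_cast (card_le_card hbad).trans card_biUnion_le
  have hsplit : ((univ.filter P).card : ℝ) + (univ.filter fun G => ¬ P G).card =
      Fintype.card (SimpleGraph (Fin n)) := by
    exact_mod_cast card_filter_add_card_filter_not (s := univ) P
  linarith

theorem graphProb_le_one {n : ℕ} (P : SimpleGraph (Fin n) → Prop) : graphProb n P ≤ 1 := by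
  refine div_le_one_of_le₀ ?_ (Nat.cast_nonneg _)
  exact_mod_cast card_le_univ _

theorem graphProb_mono {n : ℕ} {P Q : SimpleGraph (Fin n) → Prop} (h : ∀ G, P G → Q G) :
    graphProb n P ≤ graphProb n Q := by
  unfold graphProb
  gcongr with G
  exact h G

theorem one_sub_le_graphProb_swap {δ : ℝ} (hδ : 0 < δ) (hδ' : δ < (1 / 64) ^ 3) {n : ℕ}
    (hn : 0 < n) :
    1 - 2 * (8 * Real.exp (-4)) ^ n ≤
      graphProb n (fun G => ∀ A : Finset (Fin n), IsBisection A →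
        ∀ A' B' : Finset (Fin n), A' ⊆ A → B' ⊆ Aᶜ →
          A'.card = ⌊δ * n⌋₊ → B'.card = ⌊δ * n⌋₊ →
          |(totalFriendliness G ((A \ A') ∪ B') : ℝ) - (totalFriendliness G A : ℝ)| ≤
            δ ^ (1 / 3 : ℝ) * (n : ℝ) ^ (3 / 2 : ℝ)) := by
  set c := δ ^ (1 / 3 : ℝ) with hc
  have hc0 : 0 < c := Real.rpow_pos_of_pos hδ _
  have hc3 : c ^ 3 = δ := by
    rw [hc, ← Real.rpow_natCast, ← Real.rpow_mul hδ.le]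
    norm_num
  have hc64 : c < 1 / 64 := lt_of_pow_lt_pow_left₀ 3 (by norm_num) (hc3 ▸ hδ')
  have hn0 : (0 : ℝ) < n := by exact_mod_cast hn
  have hnpow : ((n : ℝ) ^ (3 / 2 : ℝ)) ^ 2 = (n : ℝ) ^ 3 := by
    rw [← Real.rpow_natCast, ← Real.rpow_mul hn0.le, ← Real.rpow_natCast]
    norm_num
  set t := c * (n : ℝ) ^ (3 / 2 : ℝ) with ht
  have ht0 : 0 ≤ t := by positivity
  have hV : 0 < 8 * δ * (n : ℝ) ^ 2 := by positivity
  have hk : 8 * (⌊δ * n⌋₊ : ℝ) * n ≤ 8 * δ * (n : ℝ) ^ 2 := by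
    have := mul_le_mul_of_nonneg_right (Nat.floor_le (by positivity : 0 ≤ δ * n)) hn0.le
    nlinarith
  have hexp : Real.exp (-(t ^ 2 / (2 * (8 * δ * (n : ℝ) ^ 2)))) ≤ Real.exp (-4) ^ n := by
    rw [← Real.exp_nat_mul, Real.exp_le_exp, mul_neg, neg_le_neg_iff, le_div_iff₀ (by positivity),
      ht, mul_pow, hnpow, ← hc3]
    have : 0 ≤ (1 - 64 * c) * (c ^ 2 * (n : ℝ) ^ 3) :=
      mul_nonneg (by linarith) (by positivity)
    nlinarith
  let I : Finset (Finset (Fin n) × Finset (Fin n) × Finset (Fin n)) :=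
    univ.filter fun x => x.2.1 ⊆ x.1 ∧ x.2.2 ⊆ x.1ᶜ ∧
      x.2.1.card = ⌊δ * n⌋₊ ∧ x.2.2.card = ⌊δ * n⌋₊
  have hI : (I.card : ℝ) ≤ 8 ^ n := by
    have h : I.card ≤ 2 ^ n * (2 ^ n * 2 ^ n) := by
      simpa using card_le_univ I
    rw [← mul_pow, ← mul_pow] at h
    exact_mod_cast h
  have hmain := one_sub_le_graphProb_forall I
    (fun x G => |(totalFriendliness G ((x.1 \ x.2.1) ∪ x.2.2) : ℝ) - totalFriendliness G x.1| ≤ t)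
    (ε := 2 * Real.exp (-4) ^ n) (by
      rintro ⟨A, A', B'⟩ hx
      obtain ⟨hA, hB, hA', hB'⟩ := (mem_filter.1 hx).2
      simp only [not_le]
      refine (card_totalFriendliness_swap_le hA hB hA' hB' ht0 hV hk).trans ?_
      rw [mul_right_comm]
      gcongr)
  refine le_trans ?_ (hmain.trans (graphProb_mono ?_))
  · have := mul_le_mul_of_nonneg_right hI (by positivity : 0 ≤ 2 * Real.exp (-4) ^ n)
    rw [mul_pow]
    linarith
  · intro G hG A _ A' B' hA hB hA' hB'
    exact hG (A, A', B') (mem_filter.2 ⟨mem_univ _, hA, hB, hA', hB'⟩)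

/-- there is `δ₀ > 0` such that for every fixed `δ ∈ (0,δ₀)`, with high
probability, for every bisection `A ∪ Aᶜ` of `G(n,1/2)` and all `A' ⊆ A`, `B' ⊆ Aᶜ` of size
`⌊δn⌋`, the bisection `A₁ ∪ B₁` obtained by exchanging `A'` and `B'` satisfies
`|Δ_{A₁,B₁} - Δ_{A,Aᶜ}| ≤ δ^{1/3} n^{3/2}`. -/
theorem statement6 :
    ∃ δ₀ : ℝ, 0 < δ₀ ∧ ∀ δ : ℝ, 0 < δ → δ < δ₀ →
      Tendsto (fun n : ℕ => graphProb n (fun G => ∀ A : Finset (Fin n), IsBisection A →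
          ∀ A' B' : Finset (Fin n), A' ⊆ A → B' ⊆ Aᶜ →
            A'.card = ⌊δ * n⌋₊ → B'.card = ⌊δ * n⌋₊ →
            |(totalFriendliness G ((A \ A') ∪ B') : ℝ) - (totalFriendliness G A : ℝ)| ≤
              δ ^ (1 / 3 : ℝ) * (n : ℝ) ^ (3 / 2 : ℝ)))
        atTop (nhds 1) := by
  refine ⟨(1 / 64) ^ 3, by norm_num, fun δ hδ hδ' => ?_⟩
  have hbase : 8 * Real.exp (-4) < 1 := by
    rw [Real.exp_neg, ← div_eq_mul_inv, div_lt_one (Real.exp_pos _)]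
    have h : Real.exp 4 = Real.exp 1 ^ 4 := by
      rw [← Real.exp_nat_mul]
      norm_num
    rw [h]
    have : (2 : ℝ) ^ 4 ≤ Real.exp 1 ^ 4 := by
      gcongr
      linarith [Real.exp_one_gt_d9]
    linarith
  have hlim : Tendsto (fun n : ℕ => 1 - 2 * (8 * Real.exp (-4)) ^ n) atTop (nhds 1) := by
    simpa using
      ((tendsto_pow_atTop_nhds_zero_of_lt_one (by positivity) hbase).const_mul 2).const_sub 1
  refine tendsto_of_tendsto_of_tendsto_of_le_of_le' hlim tendsto_const_nhds ?_
    (Eventually.of_forall fun n => graphProb_le_one _)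
  filter_upwards [eventually_gt_atTop 0] with n hn
  exact one_sub_le_graphProb_swap hδ hδ' hn
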